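/- arXiv:0902.0244 — 2 statements merged into one kernel-verified Lean document; each statement's English description precedes it below -/
import Mathlib

section
/- Let φ be a W-linear endomorphism of N with matrix A = (a_{ij}) commuting with F, and suppose that ρ(a₁₁) = ρ(a₃₃) = 1 and ρ(a₁₃) = ρ(a₃₁) = 0 (i.e. the k-linear map induced by φ on N/V(N) is the identity). Then φ(M_b) ⊆ M_b for every b ∈ k. -/
/-!
Common setup: `p` a prime, `k` an algebraically closed field of characteristic `p`,
`W = W(k)` the ring of `p`-typical Witt vectors, `σ` the Witt vector Frobenius,
`ρ : W → k` reduction (0-th coefficient), `N = W⁴` with the semilinear maps `F`, `V`,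
the Gram matrix `J'` of the alternating form, the Dieudonné submodules `M_b`, and the
coordinate map `q` for `N/V(N)`.
-/

noncomputable section

open WittVector Matrix

variable (p : ℕ) [Fact p.Prime] (k : Type) [Field k] [IsAlgClosed k] [CharP k p]

/-- The reduction map `ρ : W(k) → k` sending a Witt vector to its 0-th coefficient. -/
def redW : WittVector p k →+* k where
  toFun x := x.coeff 0
  map_one' := WittVector.one_coeff_zero p k
  map_mul' := WittVector.mul_coeff_zero
  map_zero' := WittVector.zero_coeff p k 0
  map_add' := WittVector.add_coeff_zero

/-- The Witt vector Frobenius `σ`, a ring automorphism of `W(k)` since `k` is perfect. -/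
def sigmaW : WittVector p k ≃+* WittVector p k := WittVector.frobeniusEquiv p k

/-- The standard basis vectors `e₁, e₂, e₃, e₄` of `N = W⁴` (0-indexed). -/
def eW (i : Fin 4) : Fin 4 → WittVector p k := Pi.single i 1

/-- The `σ`-semilinear map `F : N → N` with `F e₁ = e₂`, `F e₂ = -p e₁`,
`F e₃ = e₄`, `F e₄ = -p e₃`. -/
def Fmap : (Fin 4 → WittVector p k) → (Fin 4 → WittVector p k) := fun x =>
  ![-(p : WittVector p k) * sigmaW p k (x 1), sigmaW p k (x 0),
    -(p : WittVector p k) * sigmaW p k (x 3), sigmaW p k (x 2)]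

/-- The `σ⁻¹`-semilinear map `V : N → N` with `V e₁ = -e₂`, `V e₂ = p e₁`,
`V e₃ = -e₄`, `V e₄ = p e₃`. -/
def Vmap : (Fin 4 → WittVector p k) → (Fin 4 → WittVector p k) := fun x =>
  ![(p : WittVector p k) * (sigmaW p k).symm (x 1), -(sigmaW p k).symm (x 0),
    (p : WittVector p k) * (sigmaW p k).symm (x 3), -(sigmaW p k).symm (x 2)]

/-- The Gram matrix `J'` of the alternating form `⟨ , ⟩` on `N` with
`⟨e₁,e₃⟩ = 1 = -⟨e₃,e₁⟩`, `⟨e₂,e₄⟩ = p = -⟨e₄,e₂⟩`. -/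
def Jmat : Matrix (Fin 4) (Fin 4) (WittVector p k) :=
  !![0, 0, 1, 0;
     0, 0, 0, (p : WittVector p k);
     -1, 0, 0, 0;
     0, -(p : WittVector p k), 0, 0]

/-- The `W`-linear endomorphism of `N` with matrix `A` commutes with `F`. -/
def CommF (A : Matrix (Fin 4) (Fin 4) (WittVector p k)) : Prop :=
  ∀ x, A.mulVec (Fmap p k x) = Fmap p k (A.mulVec x)

/-- The `W`-submodule `M_b` of `N` spanned by `p e₁, p e₃, e₂, e₄` and `e₁ + b̃ e₃`,
where `b̃` is the Teichmüller lift of `b` (a lift of `b` under `ρ`). -/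
def Mmod (b : k) : Submodule (WittVector p k) (Fin 4 → WittVector p k) :=
  Submodule.span (WittVector p k)
    {(p : WittVector p k) • eW p k 0, (p : WittVector p k) • eW p k 2, eW p k 1, eW p k 3,
     eW p k 0 + WittVector.teichmuller p b • eW p k 2}

/-- Coordinates of the class of `x ∈ N` in `N/V(N) ≃ k²` with respect to the basis given
by the classes of `e₁` and `e₃`. -/
def qmap : (Fin 4 → WittVector p k) → (Fin 2 → k) := fun x => ![redW p k (x 0), redW p k (x 2)]

set_option linter.unusedSectionVars false in
/-- The reduction of `p` vanishes. -/
theorem redW_natCast_p : redW p k (p : WittVector p k) = 0 := by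
  rw [map_natCast, CharP.cast_eq_zero]

/-- An element of `W(k)` whose reduction vanishes is divisible by `p`. -/
theorem p_dvd_of_redW_eq_zero {y : WittVector p k} (hy : redW p k y = 0) :
    (p : WittVector p k) ∣ y :=
  Ideal.mem_span_singleton.1 ((mem_span_p_iff_coeff_zero_eq_zero y).2 hy)

/-- Membership in `M_b` only depends on the class in `N/V(N)`. -/
theorem mem_Mmod_iff (b : k) (x : Fin 4 → WittVector p k) :
    x ∈ Mmod p k b ↔ redW p k (x 2) = b * redW p k (x 0) := by
  have hb : redW p k (teichmuller p b) = b := teichmuller_coeff_zero p b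
  constructor
  · intro hx
    induction hx using Submodule.span_induction with
    | mem y hy =>
      obtain rfl | rfl | rfl | rfl | rfl := hy <;>
        simp [eW, hb, redW_natCast_p, -map_natCast]
    | zero => simp
    | add y z _ _ hy hz => simp [hy, hz, mul_add]
    | smul c y _ hy => simp [hy, mul_left_comm]
  · intro h
    obtain ⟨c, hc⟩ : (p : WittVector p k) ∣ x 2 - teichmuller p b * x 0 :=
      p_dvd_of_redW_eq_zero p k (by rw [map_sub, map_mul, hb, h, sub_self])
    have hx : x = x 0 • (eW p k 0 + teichmuller p b • eW p k 2) +
        c • ((p : WittVector p k) • eW p k 2) + x 1 • eW p k 1 + x 3 • eW p k 3 := by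
      funext i
      fin_cases i
      · simp [eW]
      · simp [eW]
      · simp [eW]
        linear_combination hc
      · simp [eW]
    have mem : ∀ y ∈ ({(p : WittVector p k) • eW p k 0, (p : WittVector p k) • eW p k 2,
        eW p k 1, eW p k 3, eW p k 0 + teichmuller p b • eW p k 2} : Set _),
        y ∈ Mmod p k b := fun y hy => Submodule.subset_span hy
    rw [hx]
    exact add_mem (add_mem (add_mem (Submodule.smul_mem _ _ (mem _ (by simp)))
      (Submodule.smul_mem _ _ (mem _ (by simp)))) (Submodule.smul_mem _ _ (mem _ (by simp))))
      (Submodule.smul_mem _ _ (mem _ (by simp)))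

/-- `F` maps `N` into vectors whose class in `N/V(N)` vanishes. -/
theorem redW_Fmap (x : Fin 4 → WittVector p k) :
    redW p k (Fmap p k x 0) = 0 ∧ redW p k (Fmap p k x 2) = 0 := by
  simp [Fmap, redW_natCast_p, -map_natCast]

theorem Fmap_eW_zero : Fmap p k (eW p k 0) = eW p k 1 := by
  funext i
  fin_cases i <;> simp [Fmap, eW]

theorem Fmap_eW_two : Fmap p k (eW p k 2) = eW p k 3 := by
  funext i
  fin_cases i <;> simp [Fmap, eW]

/-- if `φ` commutes with `F` and induces the identity on `N/V(N)`, then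
`φ(M_b) ⊆ M_b` for every `b ∈ k`. -/
theorem mapsTo_Mb_of_reduction_id
    (A : Matrix (Fin 4) (Fin 4) (WittVector p k)) (hF : CommF p k A)
    (h11 : redW p k (A 0 0) = 1) (h33 : redW p k (A 2 2) = 1)
    (h13 : redW p k (A 0 2) = 0) (h31 : redW p k (A 2 0) = 0) :
    ∀ b : k, ∀ x ∈ Mmod p k b, A.mulVec x ∈ Mmod p k b := by
  intro b x hx
  rw [mem_Mmod_iff] at hx ⊢
  have h1 := redW_Fmap p k (A.mulVec (eW p k 0))
  have h3 := redW_Fmap p k (A.mulVec (eW p k 2))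
  rw [← hF, Fmap_eW_zero] at h1
  rw [← hF, Fmap_eW_two] at h3
  simp only [eW, mulVec_single_one, col_apply] at h1 h3
  simp only [mulVec, dotProduct, Fin.sum_univ_four, map_add, map_mul, h11, h13, h31, h33,
    h1.1, h1.2, h3.1, h3.2]
  linear_combination hx

end
end

section
/- The set of W-submodules M of N satisfying V(N) ⊆ M ⊆ N, such that the image of M in the 2-dimensional k-vector space N/V(N) is a 1-dimensional subspace, and such that F(M) = V(M), is finite of cardinality p² + 1. (These are exactly the superspecial Dieudonné submodules lying strictly between V(N) and N.) -/
/-!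
Common setup: `p` a prime, `k` an algebraically closed field of characteristic `p`,
`W = W(k)` the ring of `p`-typical Witt vectors, `σ` the Witt vector Frobenius,
`ρ : W → k` reduction (0-th coefficient), `N = W⁴` with the semilinear maps `F`, `V`,
the Gram matrix `J'` of the alternating form, the Dieudonné submodules `M_b`, and the
coordinate map `q` for `N/V(N)`.
-/

noncomputable section

open WittVector Matrix

variable (p : ℕ) [Fact p.Prime] (k : Type) [Field k] [IsAlgClosed k] [CharP k p]

set_option linter.unusedSectionVars false

/-- The preimage in `N` of the line of `N/V(N)` spanned by `w`. -/
def linePreimage (w : Fin 2 → k) : Submodule (WittVector p k) (Fin 4 → WittVector p k) where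
  carrier := {x | redW p k (x 0) * w 1 = redW p k (x 2) * w 0}
  add_mem' := by
    intro a b ha hb
    simp only [Set.mem_ofPred_eq, Pi.add_apply, map_add] at *
    rw [add_mul, add_mul, ha, hb]
  zero_mem' := by simp
  smul_mem' := by
    intro c x hx
    simp only [Set.mem_ofPred_eq, Pi.smul_apply, smul_eq_mul, map_mul] at *
    rw [mul_assoc, mul_assoc, hx]


section

variable {p k}

lemma mem_linePreimage {w : Fin 2 → k} {x : Fin 4 → WittVector p k} :
    x ∈ linePreimage p k w ↔ redW p k (x 0) * w 1 = redW p k (x 2) * w 0 := Iff.rfl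

lemma redW_sigmaW (x : WittVector p k) : redW p k (sigmaW p k x) = redW p k x ^ p :=
  WittVector.coeff_frobenius_charP p x 0

lemma redW_sigmaW_symm_pow (x : WittVector p k) :
    redW p k ((sigmaW p k).symm x) ^ p = redW p k x := by
  rw [← redW_sigmaW, RingEquiv.apply_symm_apply]

lemma redW_teichmuller (a : k) : redW p k (WittVector.teichmuller p a) = a :=
  WittVector.teichmuller_coeff_zero p a

lemma redW_natCast_mul (x : WittVector p k) : redW p k ((p : WittVector p k) * x) = 0 := by
  rw [map_mul, map_natCast, CharP.cast_eq_zero, zero_mul]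

lemma redW_eq_zero_iff_dvd {x : WittVector p k} :
    redW p k x = 0 ↔ (p : WittVector p k) ∣ x := by
  refine ⟨fun h => ?_, ?_⟩
  · rw [← Ideal.mem_span_singleton]
    exact (WittVector.mem_span_p_iff_coeff_zero_eq_zero x).2 h
  · rintro ⟨y, rfl⟩
    exact redW_natCast_mul y

/-- The kernel of the reduction `N → N/V(N)` is `V(N)`. -/
lemma exists_Vmap_eq {x : Fin 4 → WittVector p k} (h0 : redW p k (x 0) = 0)
    (h2 : redW p k (x 2) = 0) : ∃ z, Vmap p k z = x := by
  obtain ⟨a, ha⟩ := redW_eq_zero_iff_dvd.1 h0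
  obtain ⟨c, hc⟩ := redW_eq_zero_iff_dvd.1 h2
  refine ⟨![-sigmaW p k (x 1), sigmaW p k a, -sigmaW p k (x 3), sigmaW p k c], ?_⟩
  funext i
  fin_cases i <;> simp [Vmap, ha, hc]

lemma Vmap_mem_linePreimage (w : Fin 2 → k) (x : Fin 4 → WittVector p k) :
    Vmap p k x ∈ linePreimage p k w := by
  have h0 : redW p k (Vmap p k x 0) = 0 := redW_natCast_mul _
  have h2 : redW p k (Vmap p k x 2) = 0 := redW_natCast_mul _
  rw [mem_linePreimage, h0, h2, zero_mul, zero_mul]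

lemma exists_smul_eq {w : Fin 2 → k} (hw : w ≠ 0) {u : Fin 2 → k}
    (h : u 0 * w 1 = u 1 * w 0) : ∃ c : k, c • w = u := by
  by_cases h0 : w 0 = 0
  · have h1 : w 1 ≠ 0 := fun h1 => hw (by funext i; fin_cases i <;> simp [h0, h1])
    have hu : u 0 = 0 := by simpa [h0, h1] using h
    refine ⟨u 1 / w 1, ?_⟩
    funext i
    fin_cases i <;> simp [h0, h1, hu]
  · refine ⟨u 0 / w 0, ?_⟩
    funext i
    fin_cases i
    · simp [h0]
    · simp only [Pi.smul_apply, smul_eq_mul, Fin.mk_one]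
      field_simp
      linear_combination h

lemma qmap_image_linePreimage {w : Fin 2 → k} (hw : w ≠ 0) :
    qmap p k '' (linePreimage p k w : Set (Fin 4 → WittVector p k)) =
      Set.range fun c : k => c • w := by
  ext u
  constructor
  · rintro ⟨x, hx, rfl⟩
    exact exists_smul_eq hw hx
  · rintro ⟨c, rfl⟩
    refine ⟨![WittVector.teichmuller p (c * w 0), 0, WittVector.teichmuller p (c * w 1), 0],
      ?_, ?_⟩
    · rw [SetLike.mem_coe, mem_linePreimage]
      simp only [cons_val_zero, cons_val, redW_teichmuller]
      ring
    · funext i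
      fin_cases i <;> simp [qmap, redW_teichmuller]

lemma eq_linePreimage {M : Submodule (WittVector p k) (Fin 4 → WittVector p k)}
    (hV : ∀ x, Vmap p k x ∈ M) {w : Fin 2 → k} (hw : w ≠ 0)
    (hM : qmap p k '' (M : Set (Fin 4 → WittVector p k)) = Set.range fun c : k => c • w) :
    M = linePreimage p k w := by
  ext x
  constructor
  · intro hx
    obtain ⟨c, hc⟩ := hM.subset ⟨x, hx, rfl⟩
    have h0 : c * w 0 = redW p k (x 0) := congrFun hc 0
    have h1 : c * w 1 = redW p k (x 2) := congrFun hc 1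
    rw [mem_linePreimage, ← h0, ← h1]
    ring
  · intro hx
    obtain ⟨y, hy, hyx⟩ := hM.superset (exists_smul_eq (u := qmap p k x) hw hx)
    have h0 : redW p k (y 0) = redW p k (x 0) := congrFun hyx 0
    have h2 : redW p k (y 2) = redW p k (x 2) := congrFun hyx 1
    obtain ⟨z, hz⟩ := exists_Vmap_eq (x := x - y)
      (by rw [Pi.sub_apply, map_sub, h0, sub_self])
      (by rw [Pi.sub_apply, map_sub, h2, sub_self])
    rw [← sub_add_cancel x y, ← hz]
    exact M.add_mem (hV z) hy

lemma linePreimage_smul {c : k} (hc : c ≠ 0) (w : Fin 2 → k) :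
    linePreimage p k (c • w) = linePreimage p k w := by
  ext x
  simp only [mem_linePreimage, Pi.smul_apply, smul_eq_mul, mul_left_comm _ c]
  exact mul_right_inj' hc

lemma mem_Fmap_image {w : Fin 2 → k} {y : Fin 4 → WittVector p k} :
    y ∈ Fmap p k '' (linePreimage p k w : Set (Fin 4 → WittVector p k)) ↔
      redW p k (y 0) = 0 ∧ redW p k (y 2) = 0 ∧
        redW p k (y 1) * w 1 ^ p = redW p k (y 3) * w 0 ^ p := by
  constructor
  · rintro ⟨x, hx, rfl⟩
    rw [SetLike.mem_coe, mem_linePreimage] at hx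
    refine ⟨?_, ?_, ?_⟩
    · simp [Fmap]
    · simp [Fmap]
    · simp only [Fmap, cons_val_one, cons_val_zero, cons_val, redW_sigmaW, ← mul_pow, hx]
  · rintro ⟨h0, h2, h⟩
    obtain ⟨a, ha⟩ := redW_eq_zero_iff_dvd.1 h0
    obtain ⟨c, hc⟩ := redW_eq_zero_iff_dvd.1 h2
    refine ⟨![(sigmaW p k).symm (y 1), -(sigmaW p k).symm a, (sigmaW p k).symm (y 3),
      -(sigmaW p k).symm c], ?_, ?_⟩
    · rw [SetLike.mem_coe, mem_linePreimage]
      apply frobenius_inj k p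
      simp only [frobenius_def, mul_pow, cons_val_zero, cons_val, redW_sigmaW_symm_pow, h]
    · funext i
      fin_cases i <;> simp [Fmap, ha, hc]

lemma redW_Vmap_one_pow (x : Fin 4 → WittVector p k) :
    redW p k (Vmap p k x 1) ^ p = -redW p k (x 0) := by
  rw [← redW_sigmaW]
  simp [Vmap]

lemma redW_Vmap_three_pow (x : Fin 4 → WittVector p k) :
    redW p k (Vmap p k x 3) ^ p = -redW p k (x 2) := by
  rw [← redW_sigmaW]
  simp [Vmap]

lemma mem_Vmap_image {w : Fin 2 → k} {y : Fin 4 → WittVector p k} :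
    y ∈ Vmap p k '' (linePreimage p k w : Set (Fin 4 → WittVector p k)) ↔
      redW p k (y 0) = 0 ∧ redW p k (y 2) = 0 ∧
        redW p k (y 1) ^ p * w 1 = redW p k (y 3) ^ p * w 0 := by
  constructor
  · rintro ⟨x, hx, rfl⟩
    rw [SetLike.mem_coe, mem_linePreimage] at hx
    refine ⟨redW_natCast_mul _, redW_natCast_mul _, ?_⟩
    rw [redW_Vmap_one_pow, redW_Vmap_three_pow, neg_mul, neg_mul, hx]
  · rintro ⟨h0, h2, h⟩
    obtain ⟨z, rfl⟩ := exists_Vmap_eq h0 h2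
    refine ⟨z, ?_, rfl⟩
    rw [SetLike.mem_coe, mem_linePreimage]
    rwa [redW_Vmap_one_pow, redW_Vmap_three_pow, neg_mul, neg_mul, neg_inj] at h

/-- The line spanned by `(1, b)` gives a superspecial submodule iff `b ∈ 𝔽_{p²}`. -/
lemma Fmap_image_eq_Vmap_image_iff {b : k} :
    Fmap p k '' (linePreimage p k ![1, b] : Set (Fin 4 → WittVector p k)) =
      Vmap p k '' (linePreimage p k ![1, b] : Set (Fin 4 → WittVector p k)) ↔
        b ^ p ^ 2 = b := by
  constructor
  · intro h
    have hmem : ![0, 1, 0, WittVector.teichmuller p (b ^ p)] ∈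
        Fmap p k '' (linePreimage p k ![1, b] : Set (Fin 4 → WittVector p k)) := by
      rw [mem_Fmap_image]
      simp only [cons_val_one, cons_val_zero, cons_val, redW_teichmuller, map_zero, map_one,
        one_pow, one_mul, mul_one, and_self]
    rw [h, mem_Vmap_image] at hmem
    have := hmem.2.2
    simp only [cons_val_one, cons_val_zero, cons_val, redW_teichmuller, map_one, one_pow,
      one_mul, mul_one] at this
    rw [sq, pow_mul, ← this]
  · intro h
    ext y
    rw [mem_Fmap_image, mem_Vmap_image]
    refine and_congr_right fun _ => and_congr_right fun _ => ?_
    rw [← (frobenius_inj k p).eq_iff]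
    simp only [frobenius_def, mul_pow, cons_val_one, cons_val_zero, one_pow, mul_one]
    rw [← pow_mul, ← sq, h]

lemma Fmap_image_eq_Vmap_image_infinity :
    Fmap p k '' (linePreimage p k ![0, 1] : Set (Fin 4 → WittVector p k)) =
      Vmap p k '' (linePreimage p k ![0, 1] : Set (Fin 4 → WittVector p k)) := by
  have hp : p ≠ 0 := (Fact.out : p.Prime).ne_zero
  ext y
  rw [mem_Fmap_image, mem_Vmap_image]
  simp [hp]

lemma linePreimage_one_injective :
    Function.Injective fun b : k => linePreimage p k ![1, b] := by
  intro b c h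
  have hmem : ![1, 0, WittVector.teichmuller p b, 0] ∈ linePreimage p k ![1, b] := by
    simp [mem_linePreimage, redW_teichmuller]
  have h' : linePreimage p k ![1, b] = linePreimage p k ![1, c] := h
  rw [h', mem_linePreimage] at hmem
  simpa [redW_teichmuller] using hmem.symm

lemma linePreimage_infinity_ne (b : k) :
    linePreimage p k ![0, 1] ≠ linePreimage p k ![1, b] := by
  intro h
  have hmem : ![0, 0, 1, 0] ∈ linePreimage p k ![0, 1] := by
    simp [mem_linePreimage]
  rw [h, mem_linePreimage] at hmem
  simp at hmem

variable (p k) in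
lemma finite_and_ncard_pow_sq_eq_self :
    {b : k | b ^ p ^ 2 = b}.Finite ∧ {b : k | b ^ p ^ 2 = b}.ncard = p ^ 2 := by
  have hp : 1 < p := (Fact.out : p.Prime).one_lt
  have hne : (Polynomial.X ^ p ^ 2 - Polynomial.X : Polynomial k) ≠ 0 :=
    FiniteField.X_pow_card_pow_sub_X_ne_zero k two_ne_zero hp
  have hset : {b : k | b ^ p ^ 2 = b} =
      (Polynomial.X ^ p ^ 2 - Polynomial.X : Polynomial k).rootSet k := by
    ext b
    simp [Polynomial.mem_rootSet, hne, sub_eq_zero]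
  rw [hset]
  refine ⟨Polynomial.rootSet_finite _ _, ?_⟩
  rw [← Nat.card_coe_set_eq, Nat.card_eq_fintype_card,
    Polynomial.card_rootSet_eq_natDegree
      (galois_poly_separable p _ (dvd_pow_self p two_ne_zero)) (IsAlgClosed.splits _),
    FiniteField.X_pow_card_pow_sub_X_natDegree_eq k two_ne_zero hp]

variable (p k) in
lemma setOf_superspecial_eq :
    {M : Submodule (WittVector p k) (Fin 4 → WittVector p k) |
        (∀ x, Vmap p k x ∈ M) ∧
        (∃ w : Fin 2 → k, w ≠ 0 ∧
          qmap p k '' (M : Set (Fin 4 → WittVector p k)) = Set.range fun c : k => c • w) ∧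
        Fmap p k '' (M : Set (Fin 4 → WittVector p k)) =
          Vmap p k '' (M : Set (Fin 4 → WittVector p k))} =
      insert (linePreimage p k ![0, 1])
        ((fun b : k => linePreimage p k ![1, b]) '' {b : k | b ^ p ^ 2 = b}) := by
  ext M
  constructor
  · rintro ⟨hV, ⟨w, hw, hM⟩, hFV⟩
    obtain rfl := eq_linePreimage hV hw hM
    by_cases h0 : w 0 = 0
    · have h1 : w 1 ≠ 0 := fun h1 => hw (by funext i; fin_cases i <;> simp [h0, h1])
      left
      rw [← linePreimage_smul h1 ![0, 1]]
      congr 1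
      funext i
      fin_cases i <;> simp [h0]
    · right
      have hw' : linePreimage p k w = linePreimage p k ![1, w 1 / w 0] := by
        rw [← linePreimage_smul h0 ![1, w 1 / w 0]]
        congr 1
        funext i
        fin_cases i <;> simp [mul_div_cancel₀, h0]
      rw [hw'] at hFV ⊢
      exact ⟨w 1 / w 0, Fmap_image_eq_Vmap_image_iff.1 hFV, rfl⟩
  · rintro (rfl | ⟨b, hb, rfl⟩)
    · have hw : (![0, 1] : Fin 2 → k) ≠ 0 := fun h => one_ne_zero (congrFun h 1)
      exact ⟨Vmap_mem_linePreimage _, ⟨_, hw, qmap_image_linePreimage hw⟩,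
        Fmap_image_eq_Vmap_image_infinity⟩
    · have hw : (![1, b] : Fin 2 → k) ≠ 0 := fun h => one_ne_zero (congrFun h 0)
      exact ⟨Vmap_mem_linePreimage _, ⟨_, hw, qmap_image_linePreimage hw⟩,
        Fmap_image_eq_Vmap_image_iff.2 hb⟩

end

/-- there are exactly `p² + 1` superspecial Dieudonné submodules `M` with
`V(N) ⊆ M ⊆ N` whose image in `N/V(N) ≅ k²` is a 1-dimensional subspace and `F(M) = V(M)`. -/
theorem card_superspecial_submodules :
    {M : Submodule (WittVector p k) (Fin 4 → WittVector p k) |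
        (∀ x, Vmap p k x ∈ M) ∧
        (∃ w : Fin 2 → k, w ≠ 0 ∧
          qmap p k '' (M : Set (Fin 4 → WittVector p k)) = Set.range fun c : k => c • w) ∧
        Fmap p k '' (M : Set (Fin 4 → WittVector p k)) =
          Vmap p k '' (M : Set (Fin 4 → WittVector p k))}.Finite ∧
    {M : Submodule (WittVector p k) (Fin 4 → WittVector p k) |
        (∀ x, Vmap p k x ∈ M) ∧
        (∃ w : Fin 2 → k, w ≠ 0 ∧
          qmap p k '' (M : Set (Fin 4 → WittVector p k)) = Set.range fun c : k => c • w) ∧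
        Fmap p k '' (M : Set (Fin 4 → WittVector p k)) =
          Vmap p k '' (M : Set (Fin 4 → WittVector p k))}.ncard = p ^ 2 + 1 := by
  obtain ⟨hfin, hcard⟩ := finite_and_ncard_pow_sq_eq_self p k
  rw [setOf_superspecial_eq]
  refine ⟨(hfin.image _).insert _, ?_⟩
  rw [Set.ncard_insert_of_notMem _ (hfin.image _),
    Set.ncard_image_of_injective _ linePreimage_one_injective, hcard]
  rintro ⟨b, -, hb⟩
  exact linePreimage_infinity_ne b hb.symm


end
end
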